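/- Let λ > 0, n a positive integer, and α ∈ (n−1, n). Let u : ℝ → ℂ be n-times continuously differentiable with u^{(j)} ∈ L¹(ℝ) for 0 ≤ j ≤ n and u^{(j)}(x) → 0 as |x| → ∞ for 0 ≤ j < n. Set H(x) = (1/Γ(n−α)) ∫_{x}^{∞} (ξ−x)^{n−α−1} e^{−λξ} u(ξ) dξ, assume H is n-times differentiable and that the right tempered fractional derivative (D_+^{α,λ}u)(x) = (−1)^n e^{λx} H^{(n)}(x) belongs to L¹(ℝ). Then for every ω ∈ ℝ, F(D_+^{α,λ}u)(ω) = (λ − iω)^{α} û(ω). -/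

import Mathlib

open MeasureTheory Filter

/-- Fourier transform with convention `û(ω) = ∫ e^{-iωx} u(x) dx`. -/
noncomputable def fourierT (u : ℝ → ℂ) (ω : ℝ) : ℂ :=
  ∫ x : ℝ, Complex.exp (-(Complex.I * ω * x)) * u x

/-- The fractional integral `H(x) = (1/Γ(n-α)) ∫_x^∞ (ξ-x)^{n-α-1} e^{-λξ} u(ξ) dξ`. -/
noncomputable def rightFracH (lam : ℝ) (n : ℕ) (α : ℝ) (u : ℝ → ℂ) (x : ℝ) : ℂ :=
  (1 / Real.Gamma ((n : ℝ) - α) : ℝ) •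
    ∫ ξ in Set.Ioi x, ((ξ - x) ^ ((n : ℝ) - α - 1) * Real.exp (-(lam * ξ)) : ℝ) • u ξ

/-- Right Riemann–Liouville tempered fractional derivative
`(D_+^{α,λ}u)(x) = (-1)^n e^{λx} H^{(n)}(x)`. -/
noncomputable def rightTD (lam : ℝ) (n : ℕ) (α : ℝ) (u : ℝ → ℂ) (x : ℝ) : ℂ :=
  ((-1 : ℝ) ^ n * Real.exp (lam * x) : ℝ) • iteratedDeriv n (rightFracH lam n α u) x

lemma integrableOn_rpow_mul_cexp_neg_mul {s : ℝ} (hs : 0 < s) {c : ℂ} (hc : 0 < c.re) :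
    IntegrableOn (fun t : ℝ => ((t ^ (s - 1) : ℝ) : ℂ) * Complex.exp (-(c * t))) (Set.Ioi 0) := by
  have h := integrableOn_rpow_mul_exp_neg_mul_rpow (s := s - 1) (by linarith) one_pos hc
  refine Integrable.mono' h (Measurable.aestronglyMeasurable (by fun_prop)) ?_
  filter_upwards [ae_restrict_mem measurableSet_Ioi] with t (ht : 0 < t)
  simp [Complex.norm_exp, abs_of_nonneg (Real.rpow_nonneg ht.le _)]

lemma hasDerivAt_integral_rpow_mul_cexp_neg_mul {s : ℝ} (hs : 0 < s) {c : ℂ} (hc : 0 < c.re) :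
    HasDerivAt (fun z : ℂ => ∫ t in Set.Ioi (0 : ℝ),
        ((t ^ (s - 1) : ℝ) : ℂ) * Complex.exp (-(z * t)))
      (∫ t in Set.Ioi (0 : ℝ), ((t ^ (s - 1) : ℝ) : ℂ) * (Complex.exp (-(c * t)) * (-t))) c := by
  have hb := integrableOn_rpow_mul_exp_neg_mul_rpow (s := s) (by linarith) one_pos (half_pos hc)
  refine (hasDerivAt_integral_of_dominated_loc_of_deriv_le (μ := volume.restrict (Set.Ioi (0 : ℝ)))
    (s := {z : ℂ | c.re / 2 < z.re})
    (F := fun (z : ℂ) (t : ℝ) => ((t ^ (s - 1) : ℝ) : ℂ) * Complex.exp (-(z * t)))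
    (F' := fun (z : ℂ) (t : ℝ) => ((t ^ (s - 1) : ℝ) : ℂ) * (Complex.exp (-(z * t)) * (-t)))
    ((isOpen_lt continuous_const Complex.continuous_re).mem_nhds (half_lt_self hc))
    (Eventually.of_forall fun z => Measurable.aestronglyMeasurable (by fun_prop))
    (integrableOn_rpow_mul_cexp_neg_mul hs hc)
    (Measurable.aestronglyMeasurable (by fun_prop)) ?_ hb ?_).2
  · filter_upwards [ae_restrict_mem measurableSet_Ioi] with t (ht : 0 < t) z hz
    have hts : t ^ s = t ^ (s - 1) * t := by
      rw [← Real.rpow_add_one ht.ne']; ring_nf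
    have hexp : Real.exp (-(z.re * t)) ≤ Real.exp (-(c.re / 2 * t)) :=
      Real.exp_le_exp.2 (neg_le_neg (mul_le_mul_of_nonneg_right (le_of_lt hz) ht.le))
    have hpos := Real.rpow_nonneg ht.le (s - 1)
    calc ‖((t ^ (s - 1) : ℝ) : ℂ) * (Complex.exp (-(z * t)) * (-t))‖
        = t ^ (s - 1) * (Real.exp (-(z.re * t)) * t) := by
          simp [Complex.norm_exp, abs_of_nonneg hpos, abs_of_pos ht]
      _ ≤ t ^ (s - 1) * (Real.exp (-(c.re / 2 * t)) * t) := by gcongr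
      _ = t ^ s * Real.exp (-(c.re / 2) * t ^ (1 : ℝ)) := by
          rw [hts, Real.rpow_one, neg_mul]; ring
  · refine Eventually.of_forall fun t z _ => ?_
    have := ((hasDerivAt_id z).mul_const (t : ℂ)).neg.cexp.const_mul (((t ^ (s - 1) : ℝ) : ℂ))
    simpa using this

lemma integral_rpow_mul_cexp_neg_mul {s : ℝ} (hs : 0 < s) {c : ℂ} (hc : 0 < c.re) :
    ∫ t in Set.Ioi (0 : ℝ), ((t ^ (s - 1) : ℝ) : ℂ) * Complex.exp (-(c * t)) =
      c ^ (-s : ℂ) * Real.Gamma s := by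
  have hopen : IsOpen {z : ℂ | 0 < z.re} := isOpen_lt continuous_const Complex.continuous_re
  have hconv : IsPreconnected {z : ℂ | 0 < z.re} := (convex_halfSpace_re_gt 0).isPreconnected
  have hf : AnalyticOnNhd ℂ (fun z : ℂ => ∫ t in Set.Ioi (0 : ℝ),
      ((t ^ (s - 1) : ℝ) : ℂ) * Complex.exp (-(z * t))) {z : ℂ | 0 < z.re} :=
    DifferentiableOn.analyticOnNhd (fun z hz =>
      (hasDerivAt_integral_rpow_mul_cexp_neg_mul hs hz).differentiableAt.differentiableWithinAt)
      hopen
  have hg : AnalyticOnNhd ℂ (fun z : ℂ => z ^ (-s : ℂ) * Real.Gamma s) {z : ℂ | 0 < z.re} :=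
    DifferentiableOn.analyticOnNhd (fun z (hz : 0 < z.re) =>
      ((differentiableAt_id.cpow_const (Or.inl hz)).mul_const _).differentiableWithinAt) hopen
  refine hf.eqOn_of_preconnected_of_frequently_eq hg hconv (z₀ := 1) (by simp) ?_ hc
  have hreal : ∀ r : ℝ, 0 < r → ∫ t in Set.Ioi (0 : ℝ),
      ((t ^ (s - 1) : ℝ) : ℂ) * Complex.exp (-((r : ℂ) * t)) =
        (r : ℂ) ^ (-s : ℂ) * Real.Gamma s := by
    intro r hr
    have h := Complex.integral_cpow_mul_exp_neg_mul_Ioi (a := (s : ℂ)) (by simpa using hs) hr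
    have harg : Complex.arg r ≠ Real.pi := by
      simp [Complex.arg_ofReal_of_nonneg hr.le, Real.pi_ne_zero.symm]
    rw [one_div, Complex.inv_cpow _ _ harg, ← Complex.cpow_neg, Complex.Gamma_ofReal] at h
    rw [← h]
    refine setIntegral_congr_fun measurableSet_Ioi fun t (ht : 0 < t) => ?_
    rw [Complex.ofReal_cpow ht.le]
    push_cast
    rfl
  have htend : Tendsto (fun r : ℝ => (r : ℂ)) (nhdsWithin 1 {1}ᶜ) (nhdsWithin 1 {1}ᶜ) := by
    refine tendsto_nhdsWithin_iff.2 ⟨?_, ?_⟩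
    · exact (Complex.continuous_ofReal.tendsto' 1 1 (by simp)).mono_left nhdsWithin_le_nhds
    · filter_upwards [self_mem_nhdsWithin] with r hr
      simpa using hr
  refine htend.frequently (Eventually.frequently ?_)
  filter_upwards [nhdsWithin_le_nhds (lt_mem_nhds (zero_lt_one' ℝ))] with r hr
  exact hreal r hr

lemma integral_mul_iteratedDeriv_of_hasCompactSupport (n : ℕ) {φ h : ℝ → ℂ}
    (hφ : ContDiff ℝ n φ) (hφc : HasCompactSupport φ) (hh : ContDiff ℝ n h) :
    ∫ x, φ x * iteratedDeriv n h x = (-1) ^ n * ∫ x, iteratedDeriv n φ x * h x := by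
  induction n generalizing φ with
  | zero => simp
  | succ n ih =>
    have hφ' : ContDiff ℝ n (deriv φ) := ((contDiff_succ_iff_deriv (n := n)).1 (mod_cast hφ)).2.2
    have hφd : Differentiable ℝ φ := hφ.differentiable (by simp)
    have hhd : Differentiable ℝ (iteratedDeriv n h) :=
      hh.differentiable_iteratedDeriv n (mod_cast Nat.lt_succ_self n)
    have hcont : Continuous (iteratedDeriv (n + 1) h) := hh.continuous_iteratedDeriv' _
    have key : ∫ x, φ x * iteratedDeriv (n + 1) h x = - ∫ x, deriv φ x * iteratedDeriv n h x := by
      refine integral_mul_deriv_eq_deriv_mul_of_integrable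
        (fun x _ => (hφd x).hasDerivAt) (fun x _ => ?_) ?_ ?_ ?_
      · rw [iteratedDeriv_succ]
        exact (hhd x).hasDerivAt
      · exact (hφ.continuous.mul hcont).integrable_of_hasCompactSupport hφc.mul_right
      · exact (hφ'.continuous.mul hhd.continuous).integrable_of_hasCompactSupport
          hφc.deriv.mul_right
      · exact (hφ.continuous.mul hhd.continuous).integrable_of_hasCompactSupport hφc.mul_right
    rw [key, ih hφ' hφc.deriv (hh.of_le (by exact_mod_cast n.le_succ)), iteratedDeriv_succ',
      pow_succ]
    ring

lemma iteratedDeriv_cexp_const_mul_ofReal (n : ℕ) (c : ℂ) :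
    (iteratedDeriv n fun x : ℝ => Complex.exp (c * x)) =
      fun x : ℝ => c ^ n * Complex.exp (c * x) := by
  induction n with
  | zero => simp
  | succ n ih =>
    rw [iteratedDeriv_succ, ih]
    funext x
    have h := (((Complex.ofRealCLM.hasDerivAt (x := x)).const_mul c).cexp).const_mul (c ^ n)
    refine (h.congr_deriv ?_).deriv
    simp
    ring

lemma integrable_comp_mul_left_mul {Ψ g : ℝ → ℂ} (hΨ : Continuous Ψ)
    (hΨb : ∃ C, ∀ x, ‖Ψ x‖ ≤ C) (hg : Integrable g) (ε : ℝ) :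
    Integrable fun x => Ψ (ε * x) * g x := by
  obtain ⟨C, hC⟩ := hΨb
  exact hg.bdd_mul (c := C) (by fun_prop) (Eventually.of_forall fun x => hC _)

lemma tendsto_integral_comp_mul_left_mul {Ψ g : ℝ → ℂ} (hΨ : Continuous Ψ)
    (hΨb : ∃ C, ∀ x, ‖Ψ x‖ ≤ C) (hg : Integrable g) :
    Tendsto (fun ε : ℝ => ∫ x, Ψ (ε * x) * g x) (nhds 0) (nhds (Ψ 0 * ∫ x, g x)) := by
  obtain ⟨C, hC⟩ := hΨb
  rw [← integral_const_mul]
  refine tendsto_integral_filter_of_dominated_convergence (fun x => C * ‖g x‖)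
    (Eventually.of_forall fun ε => ?_) (Eventually.of_forall fun ε => ?_)
    (hg.norm.const_mul C) (Eventually.of_forall fun x => ?_)
  · exact (integrable_comp_mul_left_mul hΨ ⟨C, hC⟩ hg ε).aestronglyMeasurable
  · refine Eventually.of_forall fun x => ?_
    rw [norm_mul]
    gcongr
    exact hC _
  · have : Continuous fun ε : ℝ => Ψ (ε * x) * g x := by fun_prop
    exact this.tendsto' 0 _ (by simp)

lemma integral_cexp_mul_iteratedDeriv (n : ℕ) (c : ℂ) {h : ℝ → ℂ} (hh : ContDiff ℝ n h)
    (hint : Integrable fun x : ℝ => Complex.exp (c * x) * h x)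
    (hint' : Integrable fun x : ℝ => Complex.exp (c * x) * iteratedDeriv n h x) :
    ∫ x : ℝ, Complex.exp (c * x) * iteratedDeriv n h x =
      (-c) ^ n * ∫ x : ℝ, Complex.exp (c * x) * h x := by
  obtain ⟨φ, hφc, hφ, hφ0⟩ : ∃ φ : ℝ → ℂ, HasCompactSupport φ ∧ ContDiff ℝ n φ ∧ φ 0 = 1 := by
    let b : ContDiffBump (0 : ℝ) := ⟨1, 2, one_pos, one_lt_two⟩
    refine ⟨fun x => ((b x : ℝ) : ℂ), b.hasCompactSupport.comp_left Complex.ofReal_zero,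
      Complex.ofRealCLM.contDiff.comp b.contDiff, ?_⟩
    simp [b.one_of_mem_closedBall (Metric.mem_closedBall_self b.rIn_pos.le)]
  have hφcont : ∀ i ≤ n, Continuous (iteratedDeriv i φ) := fun i hi =>
    hφ.continuous_iteratedDeriv i (mod_cast hi)
  have hφsupp : ∀ i, HasCompactSupport (iteratedDeriv i φ) := by
    intro i
    induction i with
    | zero => simpa using hφc
    | succ i ih => rw [iteratedDeriv_succ]; exact ih.deriv
  have hbdd : ∀ i ≤ n, ∃ C, ∀ x, ‖iteratedDeriv i φ x‖ ≤ C := fun i hi =>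
    (hφsupp i).exists_bound_of_continuous (hφcont i hi)
  have hexp : ContDiff ℝ n fun x : ℝ => Complex.exp (c * x) :=
    (contDiff_const.mul Complex.ofRealCLM.contDiff).cexp
  have hscale : ∀ ε : ℝ, ContDiff ℝ n fun x => φ (ε * x) := fun ε =>
    hφ.comp (contDiff_const.mul contDiff_id)
  have hparts : ∀ᶠ ε : ℝ in nhdsWithin 0 {0}ᶜ,
      ∫ x : ℝ, φ (ε * x) * (Complex.exp (c * x) * iteratedDeriv n h x) =
        (-1) ^ n * ∑ i ∈ Finset.range (n + 1), n.choose i * c ^ i * (ε : ℂ) ^ (n - i) *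
          ∫ x : ℝ, iteratedDeriv (n - i) φ (ε * x) * (Complex.exp (c * x) * h x) := by
    filter_upwards [self_mem_nhdsWithin] with ε (hε : ε ≠ 0)
    have hsupp : HasCompactSupport fun x => φ (ε * x) :=
      hφc.comp_homeomorph (Homeomorph.mulLeft₀ ε hε)
    have hibp := integral_mul_iteratedDeriv_of_hasCompactSupport n (hexp.mul (hscale ε))
      hsupp.mul_left hh
    have hleibniz : ∀ x, iteratedDeriv n (fun x : ℝ => Complex.exp (c * x) * φ (ε * x)) x * h x =
        ∑ i ∈ Finset.range (n + 1), n.choose i * c ^ i * (ε : ℂ) ^ (n - i) *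
          (iteratedDeriv (n - i) φ (ε * x) * (Complex.exp (c * x) * h x)) := by
      intro x
      have := iteratedDeriv_mul (hexp.contDiffAt (x := x)) ((hscale ε).contDiffAt (x := x))
      rw [show (fun x : ℝ => Complex.exp (c * x) * φ (ε * x)) =
        (fun x : ℝ => Complex.exp (c * x)) * fun x => φ (ε * x) from rfl, this, Finset.sum_mul]
      refine Finset.sum_congr rfl fun i _ => ?_
      rw [iteratedDeriv_cexp_const_mul_ofReal, iteratedDeriv_comp_const_smul
        (hφ.of_le (mod_cast Nat.sub_le n i)) ε]
      simp only [Complex.real_smul]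
      push_cast
      ring
    simp_rw [hleibniz] at hibp
    rw [integral_finsetSum _ fun i _ => (integrable_comp_mul_left_mul
      (hφcont _ (Nat.sub_le n i)) (hbdd _ (Nat.sub_le n i)) hint ε).const_mul _] at hibp
    simp_rw [integral_const_mul] at hibp
    rw [← hibp]
    congr with x
    ring
  have hleft := (tendsto_integral_comp_mul_left_mul hφ.continuous
    (by simpa using hbdd 0 n.zero_le) hint').mono_left (nhdsWithin_le_nhds (s := {0}ᶜ))
  have hright : Tendsto (fun ε : ℝ => (-1) ^ n * ∑ i ∈ Finset.range (n + 1),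
      n.choose i * c ^ i * (ε : ℂ) ^ (n - i) *
        ∫ x : ℝ, iteratedDeriv (n - i) φ (ε * x) * (Complex.exp (c * x) * h x))
      (nhdsWithin 0 {0}ᶜ) (nhds ((-1) ^ n * ∑ i ∈ Finset.range (n + 1),
        n.choose i * c ^ i * ((0 : ℝ) : ℂ) ^ (n - i) * (iteratedDeriv (n - i) φ 0 *
          ∫ x : ℝ, Complex.exp (c * x) * h x))) := by
    refine Tendsto.mono_left (Tendsto.const_mul _ (tendsto_finsetSum _ fun i _ => ?_))
      nhdsWithin_le_nhds
    refine Tendsto.mul ?_ (tendsto_integral_comp_mul_left_mul (hφcont _ (Nat.sub_le n i))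
      (hbdd _ (Nat.sub_le n i)) hint)
    have : Continuous fun ε : ℝ => (n.choose i : ℂ) * c ^ i * (ε : ℂ) ^ (n - i) := by fun_prop
    exact this.tendsto 0
  have hlim := tendsto_nhds_unique (hleft.congr' hparts) hright
  rw [hφ0, one_mul, Finset.sum_range_succ, Finset.sum_eq_zero fun i hi => ?_] at hlim
  · rw [hlim, neg_pow c]
    simp [hφ0]
    ring
  · have : n - i ≠ 0 := by have := Finset.mem_range.1 hi; omega
    simp [this]

lemma integrable_and_integral_cexp_mul_rightFracH {lam : ℝ} (hlam : 0 < lam) {n : ℕ} {α : ℝ}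
    (hα : α < n) {u : ℝ → ℂ} (hu : Integrable u) (ω : ℝ) :
    (Integrable fun x : ℝ =>
        Complex.exp (((lam : ℂ) - Complex.I * ω) * x) * rightFracH lam n α u x) ∧
      ∫ x : ℝ, Complex.exp (((lam : ℂ) - Complex.I * ω) * x) * rightFracH lam n α u x =
        ((lam : ℂ) - Complex.I * ω) ^ ((α : ℂ) - n) * fourierT u ω := by
  set s : ℝ := n - α with hs_def
  have hs : 0 < s := sub_pos.2 hα
  set c : ℂ := (lam : ℂ) - Complex.I * ω with hc_def
  have hc : 0 < c.re := by simpa [c] using hlam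
  let k : ℝ → ℂ := (Set.Ioi 0).indicator
    fun t => ((t ^ (s - 1) : ℝ) : ℂ) * Complex.exp (-(c * t))
  let v : ℝ → ℂ := fun x => Complex.exp (-(Complex.I * ω * x)) * u x
  have hk : Integrable k :=
    (integrableOn_rpow_mul_cexp_neg_mul hs hc).integrable_indicator measurableSet_Ioi
  have hk' : Integrable fun x => k (-x) := hk.comp_neg
  have hv : Integrable v :=
    hu.bdd_mul (c := 1) (by fun_prop) (Eventually.of_forall fun x => by simp [Complex.norm_exp])
  have hconv : (fun x : ℝ => Complex.exp (c * x) * rightFracH lam n α u x) = fun x =>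
      ((1 / Real.Gamma s : ℝ) : ℂ) *
        convolution v (fun x => k (-x)) (ContinuousLinearMap.mul ℝ ℂ) volume x := by
    funext x
    rw [rightFracH, Complex.real_smul, mul_left_comm, ← integral_const_mul, convolution_def,
      ← integral_indicator measurableSet_Ioi]
    congr 2 with ξ
    by_cases hξ : x < ξ
    · have hexp : Complex.exp (c * x) * Complex.exp (-(lam * ξ)) =
          Complex.exp (-(Complex.I * ω * ξ)) * Complex.exp (-(c * ((ξ : ℂ) - x))) := by
        rw [← Complex.exp_add, ← Complex.exp_add, hc_def]
        ring_nf
      simp only [k, v, ContinuousLinearMap.mul_apply', Set.indicator, Set.mem_Ioi, hξ, if_true,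
        neg_sub, sub_pos, Complex.real_smul]
      push_cast
      linear_combination (((ξ - x) ^ (s - 1) : ℝ) : ℂ) * u ξ * hexp
    · simp [k, Set.indicator, hξ]
  rw [hconv]
  refine ⟨(hv.integrable_convolution _ hk').const_mul _, ?_⟩
  rw [integral_const_mul, integral_convolution _ hv hk', integral_neg_eq_self,
    integral_indicator measurableSet_Ioi, integral_rpow_mul_cexp_neg_mul hs hc]
  have hΓ : (Real.Gamma s : ℂ) ≠ 0 := by exact_mod_cast (Real.Gamma_pos_of_pos hs).ne'
  rw [show ((α : ℂ) - n) = -s by rw [hs_def]; push_cast; ring]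
  simp only [ContinuousLinearMap.mul_apply', v, fourierT]
  push_cast
  field_simp

theorem fourier_rightTemperedDerivative (lam : ℝ) (hlam : 0 < lam) (n : ℕ) (hn : 0 < n)
    (α : ℝ) (hα₁ : (n : ℝ) - 1 < α) (hα₂ : α < n) (u : ℝ → ℂ)
    (hu : ContDiff ℝ n u)
    (huL1 : ∀ j : ℕ, j ≤ n → Integrable (iteratedDeriv j u))
    (huz : ∀ j : ℕ, j < n → Tendsto (iteratedDeriv j u) (cocompact ℝ) (nhds 0))
    (hH : ContDiff ℝ n (rightFracH lam n α u))
    (hD : Integrable (rightTD lam n α u)) :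
    ∀ ω : ℝ, fourierT (rightTD lam n α u) ω =
      ((lam : ℂ) - Complex.I * ω) ^ (α : ℂ) * fourierT u ω := by
  intro ω
  set c : ℂ := (lam : ℂ) - Complex.I * ω with hc_def
  have hc : c ≠ 0 := fun h => by simpa [c, hlam.ne'] using congrArg Complex.re h
  have huInt : Integrable u := by simpa using huL1 0 n.zero_le
  obtain ⟨hint, hval⟩ := integrable_and_integral_cexp_mul_rightFracH hlam hα₂ huInt ω
  have hpt : ∀ x : ℝ, Complex.exp (-(Complex.I * ω * x)) * rightTD lam n α u x =
      (-1) ^ n * (Complex.exp (c * x) * iteratedDeriv n (rightFracH lam n α u) x) := by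
    intro x
    rw [rightTD, Complex.real_smul, show c * x = -(Complex.I * ω * x) + lam * x by
      rw [hc_def]; ring, Complex.exp_add]
    push_cast
    ring
  have hint' : Integrable fun x : ℝ =>
      Complex.exp (c * x) * iteratedDeriv n (rightFracH lam n α u) x := by
    have h := (hD.bdd_mul (c := 1) (f := fun x : ℝ => Complex.exp (-(Complex.I * ω * x)))
      (by fun_prop) (Eventually.of_forall fun x => by simp [Complex.norm_exp])).const_mul
      ((-1 : ℂ) ^ n)
    refine h.congr (Eventually.of_forall fun x => ?_)
    simp only [hpt]
    rw [← mul_assoc, ← mul_pow]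
    simp
  rw [fourierT]
  simp_rw [hpt]
  rw [integral_const_mul, integral_cexp_mul_iteratedDeriv n c hH hint hint', hval, ← mul_assoc,
    ← mul_pow, ← mul_assoc, Complex.cpow_sub _ _ hc, Complex.cpow_natCast]
  have := pow_ne_zero n hc
  field_simp
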